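/- Let k ∈ ℤ with k ≠ 0 and ℓ ∈ ℕ with 1 ≤ ℓ ≤ |k|, and define the Schwartz function Φ(x₁,x₂) := π^{|k|} (−1)^k (x₂ − sgn(k)·i·x₁)^{2|k|} e^{−π(x₁²+x₂²)} on ℝ². Then for every y ∈ ℝ with y ≠ 0, the double integral W(y) := |y|^ℓ ∫_{ℝ∖{0}} |a|^{1−2ℓ} (∫_ℝ Φ(a^{−1}y, x) e^{−2πixa} dx) da/|a| converges and equals W_{|k|,ℓ−1/2}(4π|y|) if sgn(y) = sgn(k), and equals 0 if sgn(y) = −sgn(k). -/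

import Mathlib

open MeasureTheory

/-- The classical Whittaker function `W_{K,L-1/2}` for integers `K ≥ L ≥ 1`. -/
noncomputable def Whol (K L : ℕ) (u : ℝ) : ℝ :=
  (-1 : ℝ) ^ (K - L) * (K - L).factorial * (K + L - 1).factorial *
    ∑ m ∈ Finset.range (K - L + 1),
      (-1 : ℝ) ^ m / ((K - L - m).factorial * (2*L + m - 1).factorial * m.factorial) *
        u ^ (L + m) * Real.exp (-u / 2)

/-- The Schwartz function `Φ(x₁,x₂) = π^{|k|} (-1)^k (x₂ - sgn(k) i x₁)^{2|k|}
e^{-π(x₁²+x₂²)}`. -/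
noncomputable def Phi (k : ℤ) (x₁ x₂ : ℝ) : ℂ :=
  (Real.pi : ℂ) ^ k.natAbs * (-1 : ℂ) ^ k *
    ((x₂ : ℂ) - (Int.sign k : ℂ) * Complex.I * (x₁ : ℂ)) ^ (2 * k.natAbs) *
    Complex.exp (-(Real.pi : ℂ) * ((x₁ : ℂ) ^ 2 + (x₂ : ℂ) ^ 2))

theorem choose_succ_mul_cast (K j : ℕ) :
    (K.choose (j + 1) : ℝ) * (j + 1) = K.choose j * ((K : ℝ) - j) := by
  rcases le_or_gt j K with h | h
  · have := Nat.choose_succ_right_eq K j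
    have h2 := congrArg (Nat.cast (R := ℝ)) this
    push_cast [Nat.cast_sub h] at h2
    exact h2
  · simp [Nat.choose_eq_zero_of_lt h, Nat.choose_eq_zero_of_lt (h.trans (Nat.lt_succ_self j))]

/-- The coefficient of `x ^ j` in the Bessel-type polynomial of degree `L`. -/
noncomputable def besselCoeff (L j : ℕ) : ℝ :=
  ((L + j).choose (2 * j) : ℝ) * ((2 * j).factorial / j.factorial)

theorem besselCoeff_of_le {L j : ℕ} (h : j ≤ L) :
    besselCoeff L j = (L + j).factorial / ((L - j).factorial * j.factorial) := by
  obtain ⟨d, rfl⟩ := Nat.exists_eq_add_of_le h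
  have h2 : j + d + j = d + 2 * j := by ring
  have := Nat.add_choose_mul_factorial_mul_factorial d (2 * j)
  have h3 : ((d + 2 * j).factorial : ℝ) = (d + 2 * j).choose (2 * j) * d.factorial * (2 * j).factorial := by
    exact_mod_cast this.symm
  rw [besselCoeff, h2, Nat.add_sub_cancel_left, h3]
  have a1 := Nat.cast_ne_zero (R := ℝ).mpr d.factorial_ne_zero
  have a2 := Nat.cast_ne_zero (R := ℝ).mpr j.factorial_ne_zero
  field_simp

theorem sum_telescope (K L m N : ℕ) (hL : L + 1 < K) (hN : N ≤ L + 1) :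
    ∑ i ∈ Finset.range N, (-1 : ℝ) ^ i * K.choose (m + i) * (K - 1 - i).factorial *
      (((K : ℝ) - (L + 1)) * (L + 1 + m) * besselCoeff (L + 1) i
        - (K + (L + 1)) * ((m : ℝ) - (L + 1)) * besselCoeff L i) =
    -2 * N * (m + N) * ((-1 : ℝ) ^ N * K.choose (m + N) * (K - N).factorial *
      ((L + N).factorial / ((L + 1 - N).factorial * N.factorial))) := by
  induction N with
  | zero => simp
  | succ N ih =>
    rw [Finset.sum_range_succ, ih (by omega)]
    rw [besselCoeff_of_le (show N ≤ L + 1 by omega), besselCoeff_of_le (show N ≤ L by omega)]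
    obtain ⟨d, rfl⟩ := Nat.exists_eq_add_of_le (show N ≤ L by omega)
    obtain ⟨e, rfl⟩ := Nat.exists_eq_add_of_le (show N + d + 2 ≤ K by omega)
    have c := choose_succ_mul_cast (N + d + 2 + e) (m + N)
    rw [show N + d + 2 + e - 1 - N = d + 1 + e by omega, show N + d + 2 + e - N = d + 1 + e + 1 by omega,
      show N + d + 2 + e - (N + 1) = d + 1 + e by omega, show N + d + 1 - N = d + 1 by omega,
      show N + d - N = d by omega, show N + d + 1 - (N + 1) = d by omega,
      show N + d + 1 + N = N + d + N + 1 by omega, show N + d + (N + 1) = N + d + N + 1 by omega,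
      show m + (N + 1) = m + N + 1 by omega]
    simp only [Nat.factorial_succ]
    have a1 := Nat.cast_ne_zero (R := ℝ).mpr d.factorial_ne_zero
    have a2 := Nat.cast_ne_zero (R := ℝ).mpr N.factorial_ne_zero
    have a3 := Nat.cast_ne_zero (R := ℝ).mpr (N + d + N).factorial_ne_zero
    push_cast at c ⊢
    rw [pow_succ]
    have c' : ((N + d + 2 + e).choose (m + N + 1) : ℝ) =
      ((N + d + 2 + e).choose (m + N) : ℝ) * (N + d + 2 + e - (m + N)) / (m + N + 1) := by
      rw [eq_div_iff (by positivity)]; exact c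
    rw [c']
    field_simp
    ring

theorem sum_rec (K L m : ℕ) (hL : L + 1 < K) :
    ((K : ℝ) - (L + 1)) * (L + 1 + m) * ∑ i ∈ Finset.range (L + 2),
      (-1 : ℝ) ^ i * K.choose (m + i) * (K - 1 - i).factorial * besselCoeff (L + 1) i =
    (K + (L + 1)) * ((m : ℝ) - (L + 1)) * ∑ i ∈ Finset.range (L + 1),
      (-1 : ℝ) ^ i * K.choose (m + i) * (K - 1 - i).factorial * besselCoeff L i := by
  have h := sum_telescope K L m (L + 1) hL le_rfl
  rw [Finset.sum_range_succ, mul_add, besselCoeff_of_le (le_refl (L + 1))]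
  simp only [mul_sub, Finset.sum_sub_distrib] at h
  rw [Finset.mul_sum, Finset.mul_sum]
  have h1 : ∀ x y z : ℝ, x - y = z → x = y + z := fun x y z h => by linarith
  have h2 := h1 _ _ _ h
  have h3 : ∀ j c : ℕ → ℝ, ∀ t : ℝ, ∑ i ∈ Finset.range (L + 1), c i * (t * j i) = ∑ i ∈ Finset.range (L + 1), t * (c i * j i) :=
    fun j c t => Finset.sum_congr rfl fun i _ => by ring
  rw [h3, h3] at h2
  rw [h2]
  obtain ⟨e, rfl⟩ := Nat.exists_eq_add_of_le (show L + 2 ≤ K by omega)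
  rw [show L + 2 + e - (L + 1) = e + 1 by omega, show L + 2 + e - 1 - (L + 1) = e by omega,
    show L + 1 + (L + 1) = L + (L + 1) + 1 by omega]
  simp only [Nat.factorial_succ, Nat.sub_self, Nat.factorial_zero]
  have a2 := Nat.cast_ne_zero (R := ℝ).mpr L.factorial_ne_zero
  push_cast
  field_simp
  ring

/-- An instance of the Pfaff-Saalschütz summation. -/
theorem sum_besselCoeff_choose (K L m : ℕ) (hL : L + 1 ≤ K) (hm : m + 1 ≤ K) :
    ∑ i ∈ Finset.range (L + 1),
      (-1 : ℝ) ^ i * K.choose (m + 1 + i) * (K - 1 - i).factorial * besselCoeff L i =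
    (K - (L + 1)).factorial * (K + L).factorial * m.descFactorial L /
      ((K - (m + 1)).factorial * (L + m + 1).factorial) := by
  induction L with
  | zero =>
    simp only [zero_add, Finset.range_one, Finset.sum_singleton]
    rw [Nat.cast_choose ℝ hm]
    obtain ⟨e, rfl⟩ := Nat.exists_eq_add_of_le hm
    rw [show m + 1 + e - 1 = m + e by omega, show m + 1 + e = m + e + 1 by omega]
    simp [besselCoeff]
    field_simp
  | succ L ih =>
    have h := sum_rec K L (m + 1) (by omega)
    rw [ih (by omega)] at h
    have hK : ((K : ℝ) - (L + 1)) ≠ 0 := by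
      have : ((L + 1 : ℕ) : ℝ) < K := by exact_mod_cast (show L + 1 < K by omega)
      push_cast at this
      linarith
    have hD : (m.descFactorial (L + 1) : ℝ) = ((m : ℝ) - L) * m.descFactorial L := by
      rcases le_or_gt L m with h | h
      · rw [Nat.descFactorial_succ]; push_cast [Nat.cast_sub h]; rfl
      · simp [Nat.descFactorial_eq_zero_iff_lt.mpr h]
    have hq : ((L : ℝ) + 1 + (m + 1 : ℕ)) ≠ 0 := by positivity
    refine mul_left_cancel₀ (mul_ne_zero hK hq) (h.trans ?_)
    rw [hD]
    obtain ⟨e, rfl⟩ := Nat.exists_eq_add_of_le (show L + 2 ≤ K by omega)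
    rw [show L + 2 + e - (L + 1) = e + 1 by omega, show L + 2 + e - (L + 1 + 1) = e by omega,
      show L + 2 + e + (L + 1) = L + 2 + e + L + 1 by omega,
      show L + 1 + m + 1 = L + m + 1 + 1 by omega]
    simp only [Nat.factorial_succ]
    push_cast
    field_simp
    ring

/-- The Pochhammer symbol `(1/2)_q`. -/
noncomputable def halfPoch (q : ℕ) : ℝ := (2 * q).factorial / (4 ^ q * q.factorial)

theorem halfPoch_pos (q : ℕ) : 0 < halfPoch q := by
  unfold halfPoch; positivity

theorem halfPoch_zero : halfPoch 0 = 1 := by simp [halfPoch]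

theorem halfPoch_succ (q : ℕ) : halfPoch (q + 1) = (q + 1 / 2) * halfPoch q := by
  unfold halfPoch
  rw [show 2 * (q + 1) = 2 * q + 1 + 1 by ring]
  simp only [Nat.factorial_succ]
  push_cast
  field_simp
  ring

theorem fwdDiff_iter_halfPoch_div (i p n : ℕ) :
    (fwdDiff 1)^[n] (fun s : ℕ => halfPoch (i + s) / halfPoch (p + s)) =
      (∏ j ∈ Finset.range n, ((i : ℝ) - p - j)) •
        fun s : ℕ => halfPoch (i + s) / halfPoch (p + n + s) := by
  induction n generalizing p with
  | zero => simp
  | succ n ih =>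
    have h : fwdDiff 1 (fun s : ℕ => halfPoch (i + s) / halfPoch (p + s)) =
        ((i : ℝ) - p) • fun s : ℕ => halfPoch (i + s) / halfPoch (p + 1 + s) := by
      ext s
      simp only [fwdDiff, Pi.smul_apply, smul_eq_mul]
      rw [show i + (s + 1) = i + s + 1 by ring, show p + (s + 1) = p + s + 1 by ring,
        show p + 1 + s = p + s + 1 by ring, halfPoch_succ, halfPoch_succ]
      have := (halfPoch_pos (p + s)).ne'
      push_cast
      field_simp
      ring
    rw [Function.iterate_succ_apply, h, fwdDiff_iter_const_smul, ih, smul_smul,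
      Finset.prod_range_succ']
    congr 1
    · rw [mul_comm]
      congr 1
      · exact Finset.prod_congr rfl fun j _ => by push_cast; ring
      · simp
    · ext s
      rw [show p + 1 + n + s = p + (n + 1) + s by ring]

theorem sum_choose_mul_halfPoch_div (i p n : ℕ) :
    ∑ s ∈ Finset.range (n + 1), (-1 : ℝ) ^ (n - s) * n.choose s *
      (halfPoch (i + s) / halfPoch (p + s)) =
    (∏ j ∈ Finset.range n, ((i : ℝ) - p - j)) * (halfPoch i / halfPoch (p + n)) := by
  have h := fwdDiff_iter_eq_sum_shift 1 (fun s : ℕ => halfPoch (i + s) / halfPoch (p + s)) n 0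
  rw [fwdDiff_iter_halfPoch_div] at h
  simp only [Pi.smul_apply, smul_eq_mul, add_zero, zero_add, mul_one, zsmul_eq_mul] at h
  rw [h]
  exact Finset.sum_congr rfl fun s _ => by push_cast; ring

theorem sum_choose_choose_mul_halfPoch_div (i p K : ℕ) (hp : p ≤ K) :
    ∑ r ∈ Finset.range (K + 1), (-1 : ℝ) ^ (K - r) * K.choose r * r.choose p *
      (halfPoch (i + (r - p)) / halfPoch r) =
    K.choose p * ((∏ j ∈ Finset.range (K - p), ((i : ℝ) - p - j)) * (halfPoch i / halfPoch K)) := by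
  obtain ⟨n, rfl⟩ := Nat.exists_eq_add_of_le hp
  have h := sum_choose_mul_halfPoch_div i p n
  rw [Nat.add_sub_cancel_left, ← h, add_assoc, Finset.sum_range_add, Finset.sum_eq_zero, zero_add,
    Finset.mul_sum]
  · refine Finset.sum_congr rfl fun s _ => ?_
    have h1 := Nat.choose_mul (n := p + n) (k := p + s) (s := p) (by omega)
    have h2 : ((p + n).choose (p + s) : ℝ) * (p + s).choose p = (p + n).choose p * n.choose s := by
      have := congrArg (Nat.cast (R := ℝ)) h1
      rw [Nat.add_sub_cancel_left, Nat.add_sub_cancel_left] at this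
      exact_mod_cast this
    rw [show p + n - (p + s) = n - s by omega, Nat.add_sub_cancel_left, mul_assoc ((-1 : ℝ) ^ (n - s)), h2]
    ring
  · intro r hr
    rw [Nat.choose_eq_zero_of_lt (Finset.mem_range.mp hr)]
    simp

/-- The coefficients, in powers of `X ^ 2`, of `4 ^ (-K)` times the physicists' Hermite
polynomial of degree `2 * K`. -/
noncomputable def hermiteCoeff (K r : ℕ) : ℝ :=
  (-1 : ℝ) ^ (K - r) * K.choose r * (halfPoch K / halfPoch r)

theorem sum_hermiteCoeff_moment (K i : ℕ) (d v : ℝ) (hv : v ≠ 0) :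
    ∑ r ∈ Finset.range (K + 1), hermiteCoeff K r * v ^ r *
      ∑ q ∈ Finset.range (r + 1), d ^ q * r.choose q * (halfPoch (i + (r - q)) / v ^ (i + (r - q))) =
    halfPoch i / v ^ i * ∑ p ∈ Finset.range (K + 1), K.choose p * (d * v) ^ p *
      ∏ j ∈ Finset.range (K - p), ((i : ℝ) - p - j) := by
  have h1 : ∀ r ∈ Finset.range (K + 1), hermiteCoeff K r * v ^ r *
      ∑ q ∈ Finset.range (r + 1), d ^ q * r.choose q * (halfPoch (i + (r - q)) / v ^ (i + (r - q))) =
      ∑ p ∈ Finset.range (K + 1), (d * v) ^ p / v ^ i * halfPoch K *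
        ((-1 : ℝ) ^ (K - r) * K.choose r * r.choose p * (halfPoch (i + (r - p)) / halfPoch r)) := by
    intro r hr
    rw [Finset.mul_sum]
    have hr' : r + 1 ≤ K + 1 := Finset.mem_range.mp hr
    refine (Finset.sum_congr rfl ?_).trans
      (Finset.sum_subset (Finset.range_subset_range.mpr hr') ?_)
    · intro q hq
      obtain ⟨e, rfl⟩ := Nat.exists_eq_add_of_le (Nat.lt_succ_iff.mp (Finset.mem_range.mp hq))
      rw [hermiteCoeff, Nat.add_sub_cancel_left, mul_pow, pow_add v q e, pow_add v i e]
      have := (halfPoch_pos (q + e)).ne'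
      field_simp
    · intro p _ hp
      rw [Nat.choose_eq_zero_of_lt (show r < p by simpa using hp)]
      simp
  rw [Finset.sum_congr rfl h1, Finset.sum_comm, Finset.mul_sum]
  refine Finset.sum_congr rfl fun p hp => ?_
  rw [← Finset.mul_sum, sum_choose_choose_mul_halfPoch_div i p K (Nat.lt_succ_iff.mp (Finset.mem_range.mp hp))]
  have := (halfPoch_pos K).ne'
  field_simp

theorem prod_range_eq_zero_of_lt {i p n : ℕ} (h : p ≤ i) (h' : i < p + n) :
    ∏ j ∈ Finset.range n, ((i : ℝ) - p - j) = 0 := by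
  refine Finset.prod_eq_zero (Finset.mem_range.mpr (show i - p < n by omega)) ?_
  push_cast [Nat.cast_sub h]
  ring

theorem sum_hermiteCoeff_moment_zero (K i : ℕ) (v : ℝ) (hv : v ≠ 0) (hi : i < K) :
    ∑ r ∈ Finset.range (K + 1), hermiteCoeff K r * v ^ r *
      ∑ q ∈ Finset.range (r + 1), (0 : ℝ) ^ q * r.choose q *
        (halfPoch (i + (r - q)) / v ^ (i + (r - q))) = 0 := by
  rw [sum_hermiteCoeff_moment K i 0 v hv, Finset.sum_eq_zero, mul_zero]
  intro p _
  rcases Nat.eq_zero_or_pos p with rfl | hp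
  · rw [prod_range_eq_zero_of_lt (Nat.zero_le i) (by omega), mul_zero]
  · rw [zero_mul, zero_pow hp.ne']
    simp

theorem prod_range_neg (i m n : ℕ) :
    ∏ j ∈ Finset.range n, ((i : ℝ) - (i + 1 + m : ℕ) - j) =
      (-1) ^ n * ((m + n).factorial / m.factorial) := by
  induction n with
  | zero => simp; field_simp
  | succ n ih =>
    rw [Finset.prod_range_succ, ih, ← add_assoc, Nat.factorial_succ]
    push_cast
    ring

theorem sum_hermiteCoeff_moment_four (K i : ℕ) (v : ℝ) (hv : v ≠ 0) (hi : i < K) :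
    ∑ r ∈ Finset.range (K + 1), hermiteCoeff K r * v ^ r *
      ∑ q ∈ Finset.range (r + 1), (4 : ℝ) ^ q * r.choose q *
        (halfPoch (i + (r - q)) / v ^ (i + (r - q))) =
    ∑ m ∈ Finset.range K, (-1 : ℝ) ^ (K + m + 1) * (4 * v) ^ (m + 1) / m.factorial *
      ((2 * i).factorial / i.factorial) *
        ((-1) ^ i * K.choose (m + 1 + i) * (K - 1 - i).factorial) := by
  rw [sum_hermiteCoeff_moment K i 4 v hv, show K + 1 = (i + 1) + (K - i) by omega,
    Finset.sum_range_add, Finset.sum_eq_zero, zero_add, Finset.mul_sum]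
  · refine (Finset.sum_congr rfl ?_).trans
      (Finset.sum_subset (Finset.range_subset_range.mpr (Nat.sub_le K i)) ?_)
    · intro m hm
      obtain ⟨n, rfl⟩ := Nat.exists_eq_add_of_le (show i + m + 1 ≤ K by have := Finset.mem_range.mp hm; omega)
      rw [show i + m + 1 + n - (i + 1 + m) = n by omega, prod_range_neg,
        show i + m + 1 + n - 1 - i = m + n by omega, show m + 1 + i = i + 1 + m by ring,
        show i + m + 1 + n + m + 1 = i + n + 2 * (m + 1) by ring, pow_add (-1 : ℝ) (i + n), pow_mul,
        pow_add (-1 : ℝ) i n, halfPoch, show i + 1 + m = i + (m + 1) by ring, pow_add (4 * v) i,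
        mul_pow 4 v i]
      have h : ((-1 : ℝ) ^ i) * (-1) ^ i = 1 := by rw [← mul_pow]; simp
      field_simp
      simp only [one_pow]
      linear_combination (-((i + m + 1 + n).choose (i + (m + 1)) : ℝ)) * h
    · intro m _ hm
      rw [Nat.choose_eq_zero_of_lt (show K < m + 1 + i by
        have : K - i ≤ m := by simpa using hm
        omega)]
      simp
  · intro p hp
    have := Finset.mem_range.mp hp
    rw [prod_range_eq_zero_of_lt (by omega) (by omega), mul_zero]

theorem sum_choose_moment_zero (K L : ℕ) (hL : L < K) (v : ℝ) (hv : v ≠ 0) :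
    ∑ i ∈ Finset.range (L + 1), ((L + i).choose (2 * i) : ℝ) *
      ∑ r ∈ Finset.range (K + 1), hermiteCoeff K r * v ^ r *
        ∑ q ∈ Finset.range (r + 1), (0 : ℝ) ^ q * r.choose q *
          (halfPoch (i + (r - q)) / v ^ (i + (r - q))) = 0 :=
  Finset.sum_eq_zero fun i hi => by
    rw [sum_hermiteCoeff_moment_zero K i v hv (by have := Finset.mem_range.mp hi; omega), mul_zero]

theorem sum_choose_moment_four (K L : ℕ) (hL : L < K) (v : ℝ) (hv : v ≠ 0) :
    Real.exp (-(2 * v)) * ∑ i ∈ Finset.range (L + 1), ((L + i).choose (2 * i) : ℝ) *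
      ∑ r ∈ Finset.range (K + 1), hermiteCoeff K r * v ^ r *
        ∑ q ∈ Finset.range (r + 1), (4 : ℝ) ^ q * r.choose q *
          (halfPoch (i + (r - q)) / v ^ (i + (r - q))) = Whol K (L + 1) (4 * v) := by
  have h1 : ∀ i ∈ Finset.range (L + 1), ((L + i).choose (2 * i) : ℝ) *
      ∑ r ∈ Finset.range (K + 1), hermiteCoeff K r * v ^ r *
        ∑ q ∈ Finset.range (r + 1), (4 : ℝ) ^ q * r.choose q *
          (halfPoch (i + (r - q)) / v ^ (i + (r - q))) =
      ∑ m ∈ Finset.range K, (-1 : ℝ) ^ (K + m + 1) * (4 * v) ^ (m + 1) / m.factorial *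
        ((-1) ^ i * K.choose (m + 1 + i) * (K - 1 - i).factorial * besselCoeff L i) := by
    intro i hi
    rw [sum_hermiteCoeff_moment_four K i v hv (by have := Finset.mem_range.mp hi; omega),
      Finset.mul_sum]
    refine Finset.sum_congr rfl fun m _ => ?_
    rw [besselCoeff]
    ring
  rw [Finset.sum_congr rfl h1, Finset.sum_comm]
  simp only [← Finset.mul_sum]
  obtain ⟨n, rfl⟩ := Nat.exists_eq_add_of_le (show L + 1 ≤ K by omega)
  rw [show Finset.range (L + 1 + n) = Finset.range (L + (n + 1)) by congr 1; ring,
    Finset.sum_range_add, Finset.sum_eq_zero, zero_add, Whol, Finset.mul_sum, Finset.mul_sum]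
  · rw [Nat.add_sub_cancel_left]
    refine Finset.sum_congr rfl fun m hm => ?_
    obtain ⟨e, rfl⟩ := Nat.exists_eq_add_of_le (Nat.lt_succ_iff.mp (Finset.mem_range.mp hm))
    rw [sum_besselCoeff_choose _ _ _ (by omega) (by omega), Nat.add_sub_cancel_left,
      Nat.add_sub_cancel_left, show L + 1 + (m + e) - (L + m + 1) = e by omega,
      show L + 1 + (m + e) + (L + 1) - 1 = L + 1 + (m + e) + L by omega,
      show 2 * (L + 1) + m - 1 = L + (L + m) + 1 by omega,
      show L + 1 + (m + e) + (L + m) + 1 = (m + e) + m + 2 * (L + 1) by ring,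
      pow_add (-1 : ℝ) (m + e + m), pow_mul, pow_add (-1 : ℝ) (m + e),
      show -(4 * v) / 2 = -(2 * v) by ring, show L + m + 1 = L + 1 + m by ring]
    have hd := Nat.factorial_mul_descFactorial (show L ≤ L + m by omega)
    rw [Nat.add_sub_cancel_left] at hd
    have hd' : ((L + m).factorial : ℝ) = m.factorial * (L + m).descFactorial L := by
      exact_mod_cast hd.symm
    have hne : ((L + m).descFactorial L : ℝ) ≠ 0 := by
      intro h0
      rw [h0, mul_zero] at hd'
      exact Nat.factorial_ne_zero _ (by exact_mod_cast hd')
    rw [hd']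
    field_simp
    simp
  · intro m hm
    rw [sum_besselCoeff_choose _ _ _ (by omega) (by have := Finset.mem_range.mp hm; omega),
      Nat.descFactorial_eq_zero_iff_lt.mpr (Finset.mem_range.mp hm)]
    simp

theorem integrable_pow_mul_cexp (c : ℝ) (hc : 0 < c) (a : ℝ) (n : ℕ) :
    Integrable fun x : ℝ => ((x : ℂ) + a * Complex.I) ^ n *
      Complex.exp (-(c : ℂ) * ((x : ℂ) + a * Complex.I) ^ 2) := by
  have h1 : ∀ m : ℕ, Integrable fun x : ℝ => (x : ℂ) ^ m *
      Complex.exp (-(c : ℂ) * ((x : ℂ) + a * Complex.I) ^ 2) := by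
    intro m
    have h := (integrable_rpow_mul_exp_neg_mul_sq hc (s := m)
      (by have : (0 : ℝ) ≤ m := m.cast_nonneg
          linarith)).norm.mul_const (Real.exp (c * a ^ 2))
    refine h.mono' (by fun_prop) (Filter.Eventually.of_forall fun x => le_of_eq ?_)
    rw [norm_mul, Complex.norm_exp, norm_pow, Complex.norm_real, norm_mul, Real.rpow_natCast,
      norm_pow, mul_assoc, Real.norm_of_nonneg (Real.exp_pos _).le, ← Real.exp_add]
    congr 2
    simp [pow_two]
    ring
  have h2 : (fun x : ℝ => ((x : ℂ) + a * Complex.I) ^ n *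
      Complex.exp (-(c : ℂ) * ((x : ℂ) + a * Complex.I) ^ 2)) =
      fun x : ℝ => ∑ m ∈ Finset.range (n + 1), ((x : ℂ) ^ m *
        Complex.exp (-(c : ℂ) * ((x : ℂ) + a * Complex.I) ^ 2)) *
          ((a * Complex.I) ^ (n - m) * n.choose m) := by
    ext x
    rw [add_pow, Finset.sum_mul]
    exact Finset.sum_congr rfl fun m _ => by ring
  rw [h2]
  exact integrable_finsetSum _ fun m _ => (h1 m).mul_const _

theorem integral_pow_succ_mul_cexp (c : ℝ) (hc : 0 < c) (a : ℝ) (n : ℕ) :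
    2 * c * (∫ x : ℝ, ((x : ℂ) + a * Complex.I) ^ (n + 1) *
      Complex.exp (-(c : ℂ) * ((x : ℂ) + a * Complex.I) ^ 2)) =
    n * ∫ x : ℝ, ((x : ℂ) + a * Complex.I) ^ (n - 1) *
      Complex.exp (-(c : ℂ) * ((x : ℂ) + a * Complex.I) ^ 2) := by
  have hd : ∀ x : ℝ, HasDerivAt (fun x : ℝ => ((x : ℂ) + a * Complex.I) ^ n *
      Complex.exp (-(c : ℂ) * ((x : ℂ) + a * Complex.I) ^ 2))
      (n * (((x : ℂ) + a * Complex.I) ^ (n - 1) *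
        Complex.exp (-(c : ℂ) * ((x : ℂ) + a * Complex.I) ^ 2)) -
      2 * c * (((x : ℂ) + a * Complex.I) ^ (n + 1) *
        Complex.exp (-(c : ℂ) * ((x : ℂ) + a * Complex.I) ^ 2))) x := by
    intro x
    have h0 : HasDerivAt (fun x : ℝ => (x : ℂ) + a * Complex.I) 1 x :=
      (Complex.ofRealCLM.hasDerivAt (x := x)).add_const _
    refine ((h0.pow n).mul ((h0.pow 2).const_mul (-(c : ℂ))).cexp).congr_deriv ?_
    simp only [Pi.pow_apply]
    push_cast
    ring
  have hi1 := (integrable_pow_mul_cexp c hc a (n - 1)).const_mul (n : ℂ)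
  have hi2 := (integrable_pow_mul_cexp c hc a (n + 1)).const_mul (2 * c : ℂ)
  have h := integral_eq_zero_of_hasDerivAt_of_integrable hd (hi1.sub hi2)
    (integrable_pow_mul_cexp c hc a n)
  rw [integral_sub hi1 hi2, integral_const_mul, integral_const_mul] at h
  exact (sub_eq_zero.mp h).symm

theorem integral_pow_even_mul_cexp (c : ℝ) (hc : 0 < c) (a : ℝ) (q : ℕ) :
    ∫ x : ℝ, ((x : ℂ) + a * Complex.I) ^ (2 * q) *
      Complex.exp (-(c : ℂ) * ((x : ℂ) + a * Complex.I) ^ 2) =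
    ((Real.sqrt (Real.pi / c) * (halfPoch q / c ^ q) : ℝ) : ℂ) := by
  induction q with
  | zero =>
    have h := GaussianFourier.integral_cexp_neg_mul_sq_add_real_mul_I (b := (c : ℂ)) (by simpa) a
    simp only [mul_zero, pow_zero, one_mul, halfPoch_zero, div_one, mul_one]
    rw [h, Real.sqrt_eq_rpow, Complex.ofReal_cpow (by positivity)]
    push_cast
    rfl
  | succ q ih =>
    have h := integral_pow_succ_mul_cexp c hc a (2 * q + 1)
    rw [Nat.add_sub_cancel, ih] at h
    have hc' : (c : ℂ) ≠ 0 := by exact_mod_cast hc.ne'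
    refine mul_left_cancel₀ (mul_ne_zero two_ne_zero hc') (h.trans ?_)
    rw [halfPoch_succ]
    push_cast
    field_simp
    ring

theorem integral_pow_odd_mul_cexp (c : ℝ) (hc : 0 < c) (a : ℝ) (q : ℕ) :
    ∫ x : ℝ, ((x : ℂ) + a * Complex.I) ^ (2 * q + 1) *
      Complex.exp (-(c : ℂ) * ((x : ℂ) + a * Complex.I) ^ 2) = 0 := by
  have hc' : (2 * c : ℂ) ≠ 0 := mul_ne_zero two_ne_zero (by exact_mod_cast hc.ne')
  induction q with
  | zero =>
    have h := integral_pow_succ_mul_cexp c hc a 0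
    rw [Nat.cast_zero, zero_mul] at h
    exact (mul_eq_zero.mp h).resolve_left hc'
  | succ q ih =>
    have h := integral_pow_succ_mul_cexp c hc a (2 * q + 2)
    rw [show 2 * q + 2 - 1 = 2 * q + 1 by omega, ih, mul_zero] at h
    exact (mul_eq_zero.mp h).resolve_left hc'

theorem sum_range_two_mul_add_one {M : Type*} [AddCommMonoid M] (f : ℕ → M) (K : ℕ) :
    ∑ q ∈ Finset.range (2 * K + 1), f q =
      ∑ r ∈ Finset.range (K + 1), f (2 * r) + ∑ r ∈ Finset.range K, f (2 * r + 1) := by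
  induction K with
  | zero => simp
  | succ K ih =>
    rw [show 2 * (K + 1) + 1 = 2 * K + 1 + 1 + 1 by ring, Finset.sum_range_succ,
      Finset.sum_range_succ, ih, Finset.sum_range_succ _ (K + 1),
      Finset.sum_range_succ (fun r => f (2 * r + 1)) K, show 2 * (K + 1) = 2 * K + 1 + 1 by ring]
    abel

theorem choose_two_mul_mul_halfPoch {K r : ℕ} (h : r ≤ K) :
    ((2 * K).choose (2 * r) : ℝ) * halfPoch (K - r) = K.choose r * (halfPoch K / halfPoch r) := by
  obtain ⟨d, rfl⟩ := Nat.exists_eq_add_of_le h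
  rw [Nat.cast_choose ℝ (show 2 * r ≤ 2 * (r + d) by omega), Nat.cast_choose ℝ h,
    show 2 * (r + d) - 2 * r = 2 * d by omega, Nat.add_sub_cancel_left]
  unfold halfPoch
  rw [pow_add]
  field_simp

theorem integral_add_pow_mul_cexp (K : ℕ) (a b : ℝ) :
    (Real.pi : ℂ) ^ K * (-1) ^ K * ∫ x : ℝ, (((x : ℂ) + a * Complex.I) - b * Complex.I) ^ (2 * K) *
      Complex.exp (-(Real.pi : ℂ) * ((x : ℂ) + a * Complex.I) ^ 2) =
    ((∑ r ∈ Finset.range (K + 1), hermiteCoeff K r * (Real.pi * b ^ 2) ^ r : ℝ) : ℂ) := by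
  have h2 : (fun x : ℝ => (((x : ℂ) + a * Complex.I) - b * Complex.I) ^ (2 * K) *
      Complex.exp (-(Real.pi : ℂ) * ((x : ℂ) + a * Complex.I) ^ 2)) =
      fun x : ℝ => ∑ m ∈ Finset.range (2 * K + 1), ((-b * Complex.I) ^ m * (2 * K).choose m) *
        (((x : ℂ) + a * Complex.I) ^ (2 * K - m) *
        Complex.exp (-(Real.pi : ℂ) * ((x : ℂ) + a * Complex.I) ^ 2)) := by
    ext x
    rw [sub_eq_neg_add, add_pow, Finset.sum_mul]
    exact Finset.sum_congr rfl fun m _ => by ring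
  rw [h2, integral_finsetSum _ fun m _ =>
    (integrable_pow_mul_cexp Real.pi Real.pi_pos a _).const_mul _]
  simp only [integral_const_mul]
  rw [sum_range_two_mul_add_one, Finset.sum_eq_zero (s := Finset.range K), add_zero, Finset.mul_sum]
  · push_cast
    refine Finset.sum_congr rfl fun r hr => ?_
    have hr' : r ≤ K := Nat.lt_succ_iff.mp (Finset.mem_range.mp hr)
    have hch := congrArg (Complex.ofReal) (choose_two_mul_mul_halfPoch hr')
    obtain ⟨d, rfl⟩ := Nat.exists_eq_add_of_le hr'
    rw [show 2 * (r + d) - 2 * r = 2 * (r + d - r) by omega,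
      integral_pow_even_mul_cexp _ Real.pi_pos, hermiteCoeff]
    rw [Nat.add_sub_cancel_left] at hch ⊢
    push_cast at hch ⊢
    rw [div_self Real.pi_ne_zero, Real.sqrt_one, mul_assoc ((-1 : ℂ) ^ d), ← hch, pow_mul _ 2 r, mul_pow _ Complex.I,
      Complex.I_sq, mul_pow, mul_pow, pow_add, pow_add]
    have hpi : (Real.pi : ℂ) ≠ 0 := by exact_mod_cast Real.pi_ne_zero
    have hs : ((-1 : ℂ) ^ r) * (-1) ^ r = 1 := by rw [← mul_pow]; simp
    push_cast
    field_simp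
    linear_combination ((2 * (r + d)).choose (2 * r) : ℂ) * (halfPoch d : ℂ) * ((b : ℂ) ^ 2) ^ r * hs
  · intro r hr
    have := Finset.mem_range.mp hr
    rw [show 2 * K - (2 * r + 1) = 2 * (K - r - 1) + 1 by omega,
      integral_pow_odd_mul_cexp _ Real.pi_pos, mul_zero]

theorem integral_pow_mul_exp (c : ℝ) (hc : 0 < c) (q : ℕ) :
    ∫ x : ℝ, x ^ (2 * q) * Real.exp (-c * x ^ 2) =
      Real.sqrt (Real.pi / c) * (halfPoch q / c ^ q) := by
  have h := integral_pow_even_mul_cexp c hc 0 q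
  have h2 : (fun x : ℝ => ((x : ℂ) + (0 : ℝ) * Complex.I) ^ (2 * q) *
      Complex.exp (-(c : ℂ) * ((x : ℂ) + (0 : ℝ) * Complex.I) ^ 2)) =
      fun x : ℝ => ((x ^ (2 * q) * Real.exp (-c * x ^ 2) : ℝ) : ℂ) := by
    ext x
    push_cast
    simp
  rw [h2] at h
  exact Complex.ofReal_injective (integral_ofReal.symm.trans h)

theorem integrable_pow_mul_exp (c : ℝ) (hc : 0 < c) (n : ℕ) :
    Integrable fun x : ℝ => x ^ n * Real.exp (-c * x ^ 2) := by
  have h := integrable_rpow_mul_exp_neg_mul_sq hc (s := n)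
    (by have : (0 : ℝ) ≤ n := n.cast_nonneg
        linarith)
  simpa only [Real.rpow_natCast] using h

theorem cexp_identity (a t x : ℝ) :
    Complex.exp (-(Real.pi : ℂ) * ((t : ℂ) ^ 2 + (x : ℂ) ^ 2)) *
      Complex.exp (-(2 * Real.pi) * Complex.I * x * a) =
    (Real.exp (-Real.pi * (a ^ 2 + t ^ 2)) : ℂ) *
      Complex.exp (-(Real.pi : ℂ) * ((x : ℂ) + a * Complex.I) ^ 2) := by
  push_cast
  rw [← Complex.exp_add, ← Complex.exp_add]
  congr 1
  linear_combination ((Real.pi : ℂ) * a ^ 2) * Complex.I_sq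

theorem Phi_mul_cexp (k : ℤ) (t a x : ℝ) :
    Phi k t x * Complex.exp (-(2 * Real.pi) * Complex.I * x * a) =
    ((Real.exp (-Real.pi * (a ^ 2 + t ^ 2)) : ℝ) : ℂ) * ((Real.pi : ℂ) ^ k.natAbs * (-1) ^ k.natAbs) *
      ((((x : ℂ) + a * Complex.I) - (a + Int.sign k * t : ℝ) * Complex.I) ^ (2 * k.natAbs) *
      Complex.exp (-(Real.pi : ℂ) * ((x : ℂ) + a * Complex.I) ^ 2)) := by
  have h := cexp_identity a t x
  have hk : (-1 : ℂ) ^ k = (-1) ^ k.natAbs := by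
    rcases Int.natAbs_eq k with h | h
    · conv_lhs => rw [h]
      exact zpow_natCast _ _
    · conv_lhs => rw [h]
      rw [zpow_neg, zpow_natCast, ← inv_pow, inv_neg_one]
  rw [Phi, hk, mul_assoc _ (Complex.exp _) (Complex.exp _), h]
  have h2 : (x : ℂ) + a * Complex.I - (a + Int.sign k * t : ℝ) * Complex.I =
    x - (Int.sign k : ℂ) * Complex.I * t := by push_cast; ring
  rw [h2]
  push_cast
  ring

theorem integrable_Phi_mul_cexp (k : ℤ) (t a : ℝ) :
    Integrable fun x : ℝ => Phi k t x * Complex.exp (-(2 * Real.pi) * Complex.I * x * a) := by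
  simp only [Phi_mul_cexp]
  refine Integrable.const_mul ?_ _
  have h2 : ∀ b : ℝ, (fun x : ℝ => (((x : ℂ) + a * Complex.I) - b * Complex.I) ^ (2 * k.natAbs) *
      Complex.exp (-(Real.pi : ℂ) * ((x : ℂ) + a * Complex.I) ^ 2)) =
      fun x : ℝ => ∑ m ∈ Finset.range (2 * k.natAbs + 1),
        ((-b * Complex.I) ^ m * (2 * k.natAbs).choose m) *
        (((x : ℂ) + a * Complex.I) ^ (2 * k.natAbs - m) *
        Complex.exp (-(Real.pi : ℂ) * ((x : ℂ) + a * Complex.I) ^ 2)) := by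
    intro b
    ext x
    rw [sub_eq_neg_add, add_pow, Finset.sum_mul]
    exact Finset.sum_congr rfl fun m _ => by ring
  rw [h2]
  exact integrable_finsetSum _ fun m _ =>
    (integrable_pow_mul_cexp Real.pi Real.pi_pos a _).const_mul _

theorem integral_Phi_mul_cexp (k : ℤ) (t a : ℝ) :
    ∫ x : ℝ, Phi k t x * Complex.exp (-(2 * Real.pi) * Complex.I * x * a) =
    (((∑ r ∈ Finset.range (k.natAbs + 1), hermiteCoeff k.natAbs r *
      (Real.pi * (a + Int.sign k * t) ^ 2) ^ r) * Real.exp (-Real.pi * (a ^ 2 + t ^ 2)) : ℝ) : ℂ) := by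
  simp only [Phi_mul_cexp]
  rw [integral_const_mul, mul_assoc, integral_add_pow_mul_cexp, ← Complex.ofReal_mul, mul_comm]

theorem cosh_sinh_odd_mul (L : ℕ) (x : ℝ) :
    Real.cosh ((2 * L + 1) * x) = Real.cosh x * ∑ i ∈ Finset.range (L + 1),
      ((L + i).choose (2 * i) : ℝ) * (2 * Real.sinh x) ^ (2 * i) ∧
    Real.sinh ((2 * L + 2) * x) = Real.cosh x * ∑ i ∈ Finset.range (L + 1),
      ((L + 1 + i).choose (2 * i + 1) : ℝ) * (2 * Real.sinh x) ^ (2 * i + 1) := by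
  induction L with
  | zero =>
    constructor
    · simp
    · simp [Real.sinh_two_mul]; ring
  | succ L ih =>
    have h1 : Real.cosh ((2 * (L + 1 : ℕ) + 1) * x) = Real.cosh x * ∑ i ∈ Finset.range (L + 1 + 1),
        ((L + 1 + i).choose (2 * i) : ℝ) * (2 * Real.sinh x) ^ (2 * i) := by
      have e : Real.cosh ((2 * (L + 1 : ℕ) + 1) * x) =
          Real.cosh ((2 * L + 1) * x) + 2 * Real.sinh x * Real.sinh ((2 * L + 2) * x) := by
        rw [show (2 * (L + 1 : ℕ) + 1) * x = (2 * L + 2) * x + x by push_cast; ring,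
          show (2 * L + 1) * x = (2 * L + 2) * x - x by ring, Real.cosh_add, Real.cosh_sub]
        ring
      rw [e, ih.1, ih.2, Finset.sum_range_succ' _ (L + 1), Finset.sum_range_succ' _ L,
        Finset.sum_range_succ _ L]
      have e2 : ∀ i, ((L + 1 + (i + 1)).choose (2 * (i + 1)) : ℝ) =
          (L + 1 + i).choose (2 * i + 1) + (L + (i + 1)).choose (2 * (i + 1)) := by
        intro i
        rw [show L + 1 + (i + 1) = L + 1 + i + 1 by ring, show 2 * (i + 1) = 2 * i + 1 + 1 by ring,
          Nat.choose_succ_succ, show L + (i + 1) = L + 1 + i by ring]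
        push_cast
        rfl
      simp only [e2, add_mul, Finset.sum_add_distrib]
      rw [Finset.sum_range_succ (fun i => ((L + 1 + i).choose (2 * i + 1) : ℝ) * _) L,
        Finset.sum_range_succ (fun i => ((L + (i + 1)).choose (2 * (i + 1)) : ℝ) * _) L,
        Nat.choose_eq_zero_of_lt (show L + (L + 1) < 2 * (L + 1) by omega)]
      have e3 : ∀ i, (2 * Real.sinh x) ^ (2 * (i + 1)) =
        2 * Real.sinh x * (2 * Real.sinh x) ^ (2 * i + 1) := fun i => by ring
      have e4 : ∑ i ∈ Finset.range L, ((L + 1 + i).choose (2 * i + 1) : ℝ) * (2 * Real.sinh x) ^ (2 * (i + 1)) =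
          2 * Real.sinh x * ∑ i ∈ Finset.range L, ((L + 1 + i).choose (2 * i + 1) : ℝ) *
            (2 * Real.sinh x) ^ (2 * i + 1) := by
        rw [Finset.mul_sum]
        exact Finset.sum_congr rfl fun i _ => by rw [e3]; ring
      rw [e4]
      simp only [Nat.choose_zero_right, mul_zero, Nat.cast_zero, pow_zero]
      ring
    refine ⟨h1, ?_⟩
    have e : Real.sinh ((2 * (L + 1 : ℕ) + 2) * x) =
        Real.sinh ((2 * L + 2) * x) + 2 * Real.sinh x * Real.cosh ((2 * (L + 1 : ℕ) + 1) * x) := by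
      rw [show (2 * (L + 1 : ℕ) + 2) * x = (2 * (L + 1 : ℕ) + 1) * x + x by ring,
        show (2 * L + 2) * x = (2 * (L + 1 : ℕ) + 1) * x - x by push_cast; ring,
        Real.sinh_add, Real.sinh_sub]
      ring
    rw [e, h1, ih.2, ← mul_assoc, mul_comm (2 * Real.sinh x), mul_assoc, ← mul_add, Finset.mul_sum]
    congr 1
    have e5 : ∑ i ∈ Finset.range (L + 1), ((L + 1 + i).choose (2 * i + 1) : ℝ) * (2 * Real.sinh x) ^ (2 * i + 1) =
        ∑ i ∈ Finset.range (L + 1 + 1), ((L + 1 + i).choose (2 * i + 1) : ℝ) * (2 * Real.sinh x) ^ (2 * i + 1) := by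
      rw [Finset.sum_range_succ _ (L + 1),
        Nat.choose_eq_zero_of_lt (show L + 1 + (L + 1) < 2 * (L + 1) + 1 by omega)]
      simp
    rw [e5, ← Finset.sum_add_distrib]
    refine Finset.sum_congr rfl fun i _ => ?_
    rw [show L + 1 + 1 + i = L + 1 + i + 1 by ring, Nat.choose_succ_succ]
    push_cast
    ring

theorem cosh_odd_mul (L : ℕ) (x : ℝ) :
    Real.cosh ((2 * L + 1) * x) = Real.cosh x * ∑ i ∈ Finset.range (L + 1),
      ((L + i).choose (2 * i) : ℝ) * (2 * Real.sinh x) ^ (2 * i) :=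
  (cosh_sinh_odd_mul L x).1

theorem two_mul_sinh_substitution (F : ℝ → ℝ) :
    (Integrable F ↔ Integrable fun x => 2 * Real.cosh x * F (2 * Real.sinh x)) ∧
    ∫ w, F w = ∫ x, 2 * Real.cosh x * F (2 * Real.sinh x) := by
  have himg : (fun x => 2 * Real.sinh x) '' Set.univ = Set.univ := by
    rw [Set.image_univ, Set.range_eq_univ]
    intro y
    obtain ⟨x, hx⟩ := Real.sinh_surjective (y / 2)
    exact ⟨x, by simp only [hx]; ring⟩
  have hd : ∀ x ∈ (Set.univ : Set ℝ),
      HasDerivWithinAt (fun x => 2 * Real.sinh x) (2 * Real.cosh x) Set.univ x := fun x _ =>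
    ((Real.hasDerivAt_sinh x).const_mul 2).hasDerivWithinAt
  have hinj : Set.InjOn (fun x => 2 * Real.sinh x) Set.univ := fun x _ y _ h =>
    Real.sinh_injective (mul_left_cancel₀ two_ne_zero h)
  have h1 := integrableOn_image_iff_integrableOn_abs_deriv_smul MeasurableSet.univ hd hinj F
  have h2 := integral_image_eq_integral_abs_deriv_smul MeasurableSet.univ hd hinj F
  have h3 : ∀ x : ℝ, |2 * Real.cosh x| = 2 * Real.cosh x := fun x =>
    abs_of_pos (mul_pos two_pos (Real.cosh_pos x))
  simp only [himg, integrableOn_univ, h3, smul_eq_mul, setIntegral_univ] at h1 h2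
  exact ⟨h1, h2⟩

theorem mul_exp_substitution (s : ℝ) (hs : 0 < s) (F : ℝ → ℝ) :
    (IntegrableOn F (Set.Ioi 0) ↔ Integrable fun x => s * Real.exp x * F (s * Real.exp x)) ∧
    ∫ a in Set.Ioi 0, F a = ∫ x, s * Real.exp x * F (s * Real.exp x) := by
  have himg : (fun x => s * Real.exp x) '' Set.univ = Set.Ioi 0 := by
    ext y
    simp only [Set.image_univ, Set.mem_range, Set.mem_Ioi]
    constructor
    · rintro ⟨x, rfl⟩
      positivity
    · intro hy
      exact ⟨Real.log (y / s), by rw [Real.exp_log (div_pos hy hs)]; field_simp⟩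
  have hd : ∀ x ∈ (Set.univ : Set ℝ),
      HasDerivWithinAt (fun x => s * Real.exp x) (s * Real.exp x) Set.univ x := fun x _ =>
    ((Real.hasDerivAt_exp x).const_mul s).hasDerivWithinAt
  have hinj : Set.InjOn (fun x => s * Real.exp x) Set.univ := fun x _ y _ h =>
    Real.exp_injective (mul_left_cancel₀ hs.ne' h)
  have h1 := integrableOn_image_iff_integrableOn_abs_deriv_smul MeasurableSet.univ hd hinj F
  have h2 := integral_image_eq_integral_abs_deriv_smul MeasurableSet.univ hd hinj F
  have h3 : ∀ x : ℝ, |s * Real.exp x| = s * Real.exp x := fun x =>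
    abs_of_pos (mul_pos hs (Real.exp_pos x))
  simp only [himg, integrableOn_univ, h3, smul_eq_mul, setIntegral_univ] at h1 h2
  exact ⟨h1, h2⟩

theorem integral_exp_mul_even (c : ℝ) (g : ℝ → ℝ) (hg : Continuous g) (heven : ∀ x, g (-x) = g x)
    (hint : Integrable fun x => Real.cosh (c * x) * g x) :
    (Integrable fun x => Real.exp (-(c * x)) * g x) ∧
    ∫ x, Real.exp (-(c * x)) * g x = ∫ x, Real.cosh (c * x) * g x := by
  have h1 : Integrable fun x => Real.exp (-(c * x)) * g x := by
    refine (hint.norm.const_mul 2).mono' (by fun_prop) (Filter.Eventually.of_forall fun x => ?_)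
    rw [norm_mul, norm_mul, Real.norm_of_nonneg (Real.exp_pos _).le,
      Real.norm_of_nonneg (Real.cosh_pos _).le, ← mul_assoc]
    refine mul_le_mul_of_nonneg_right ?_ (norm_nonneg _)
    rw [Real.cosh_eq]
    have := Real.exp_pos (c * x)
    linarith
  refine ⟨h1, ?_⟩
  have h2 := h1.comp_neg
  have h3 := integral_neg_eq_self (fun x => Real.exp (-(c * x)) * g x) volume
  have h4 : (fun x => Real.cosh (c * x) * g x) = fun x =>
      2⁻¹ * (Real.exp (-(c * x)) * g x + Real.exp (-(c * -x)) * g (-x)) := by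
    ext x
    rw [heven, Real.cosh_eq, mul_neg, neg_neg]
    ring
  rw [h4, integral_const_mul, integral_add h1 h2, h3]
  ring

theorem integral_zpow_mul_comp_sub_div (L : ℕ) (s : ℝ) (hs : 0 < s) (G : ℝ → ℝ) (hG : Continuous G)
    (heven : ∀ w, G (-w) = G w)
    (hint : Integrable fun w => (∑ i ∈ Finset.range (L + 1),
      ((L + i).choose (2 * i) : ℝ) * w ^ (2 * i)) * G (s * w)) :
    (IntegrableOn (fun a : ℝ => |a| ^ ((1 : ℤ) - 2 * (L + 1 : ℕ)) * G (a - s ^ 2 / a) / |a|) {0}ᶜ) ∧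
    s ^ (2 * L + 1) * ∫ a in {(0 : ℝ)}ᶜ, |a| ^ ((1 : ℤ) - 2 * (L + 1 : ℕ)) * G (a - s ^ 2 / a) / |a| =
      ∫ w, (∑ i ∈ Finset.range (L + 1), ((L + i).choose (2 * i) : ℝ) * w ^ (2 * i)) * G (s * w) := by
  set F : ℝ → ℝ := fun a => |a| ^ ((1 : ℤ) - 2 * (L + 1 : ℕ)) * G (a - s ^ 2 / a) / |a| with hF
  set P : ℝ → ℝ := fun w => (∑ i ∈ Finset.range (L + 1), ((L + i).choose (2 * i) : ℝ) * w ^ (2 * i)) *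
    G (s * w) with hP
  have hFeven : ∀ a, F (-a) = F a := by
    intro a
    simp only [hF, abs_neg]
    rw [← heven (a - s ^ 2 / a)]
    congr 3
    ring
  have hFabs : ∀ a, F |a| = F a := by
    intro a
    rcases abs_choice a with h | h <;> rw [h]
    exact hFeven a
  set g : ℝ → ℝ := fun x => G (s * (2 * Real.sinh x)) with hg
  have hcosh : (fun x => Real.cosh ((2 * L + 1) * x) * g x) =
      fun x => 2⁻¹ * (2 * Real.cosh x * P (2 * Real.sinh x)) := by
    ext x
    rw [cosh_odd_mul]
    simp only [hP, hg]
    ring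
  obtain ⟨i1, i2⟩ := two_mul_sinh_substitution P
  have hci : Integrable fun x => Real.cosh ((2 * L + 1) * x) * g x := by
    rw [hcosh]
    exact (i1.mp hint).const_mul _
  obtain ⟨j1, j2⟩ := integral_exp_mul_even (2 * L + 1) g (by fun_prop)
    (fun x => by simp only [hg, Real.sinh_neg, mul_neg, heven]) hci
  obtain ⟨k1, k2⟩ := mul_exp_substitution s hs F
  have hsub : (fun x => s * Real.exp x * F (s * Real.exp x)) =
      fun x => (s ^ (2 * L + 1))⁻¹ * (Real.exp (-((2 * L + 1) * x)) * g x) := by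
    ext x
    have hp : 0 < s * Real.exp x := by positivity
    have e1 : s * Real.exp x - s ^ 2 / (s * Real.exp x) = s * (2 * Real.sinh x) := by
      rw [Real.sinh_eq, Real.exp_neg]
      field_simp
    have e2 : Real.exp (-((2 * L + 1) * x)) = (Real.exp x ^ (2 * L + 1))⁻¹ := by
      rw [Real.exp_neg, ← Real.exp_nat_mul]
      push_cast
      rfl
    have e3 : (1 : ℤ) - 2 * (L + 1 : ℕ) = -((2 * L + 1 : ℕ) : ℤ) := by push_cast; ring
    simp only [hF, hg]
    rw [abs_of_pos hp, e1, e2, e3, zpow_neg, zpow_natCast, mul_pow]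
    field_simp
  have hFi : IntegrableOn F (Set.Ioi 0) := by
    rw [k1, hsub]
    exact j1.const_mul _
  have hFi' : Integrable F := by
    have hneg : IntegrableOn F (Set.Iic 0) := by
      have := IntegrableOn.comp_neg_Iic (c := (0 : ℝ)) (f := F)
        (by rw [neg_zero]; exact (integrableOn_Ici_iff_integrableOn_Ioi).mpr hFi)
      simpa only [hFeven] using this
    have := hneg.union hFi
    rwa [Set.Iic_union_Ioi, integrableOn_univ] at this
  refine ⟨hFi'.integrableOn, ?_⟩
  have htot : ∫ a, F a = 2 * ∫ a in Set.Ioi 0, F a := by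
    rw [← integral_comp_abs]
    simp only [hFabs]
  rw [restrict_compl_singleton, htot, k2, hsub, integral_const_mul, j2, hcosh, integral_const_mul, ← i2]
  have : s ^ (2 * L + 1) ≠ 0 := by positivity
  field_simp

theorem integral_sum_mul_hermite (K L : ℕ) (s d : ℝ) (hs : 0 < s) :
    (Integrable fun w => (∑ i ∈ Finset.range (L + 1), ((L + i).choose (2 * i) : ℝ) * w ^ (2 * i)) *
      ((∑ r ∈ Finset.range (K + 1), hermiteCoeff K r * (Real.pi * ((s * w) ^ 2 + d * s ^ 2)) ^ r) *
        Real.exp (-Real.pi * ((s * w) ^ 2 + 2 * s ^ 2)))) ∧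
    s * ∫ w, (∑ i ∈ Finset.range (L + 1), ((L + i).choose (2 * i) : ℝ) * w ^ (2 * i)) *
      ((∑ r ∈ Finset.range (K + 1), hermiteCoeff K r * (Real.pi * ((s * w) ^ 2 + d * s ^ 2)) ^ r) *
        Real.exp (-Real.pi * ((s * w) ^ 2 + 2 * s ^ 2))) =
    Real.exp (-(2 * (Real.pi * s ^ 2))) * ∑ i ∈ Finset.range (L + 1), ((L + i).choose (2 * i) : ℝ) *
      ∑ r ∈ Finset.range (K + 1), hermiteCoeff K r * (Real.pi * s ^ 2) ^ r *
        ∑ q ∈ Finset.range (r + 1), d ^ q * r.choose q *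
          (halfPoch (i + (r - q)) / (Real.pi * s ^ 2) ^ (i + (r - q))) := by
  have hv : 0 < Real.pi * s ^ 2 := by positivity
  have h1 : (fun w => (∑ i ∈ Finset.range (L + 1), ((L + i).choose (2 * i) : ℝ) * w ^ (2 * i)) *
      ((∑ r ∈ Finset.range (K + 1), hermiteCoeff K r * (Real.pi * ((s * w) ^ 2 + d * s ^ 2)) ^ r) *
        Real.exp (-Real.pi * ((s * w) ^ 2 + 2 * s ^ 2)))) =
      fun w => Real.exp (-(2 * (Real.pi * s ^ 2))) * ∑ i ∈ Finset.range (L + 1),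
        ((L + i).choose (2 * i) : ℝ) *
        ∑ r ∈ Finset.range (K + 1), hermiteCoeff K r * (Real.pi * s ^ 2) ^ r *
          ∑ q ∈ Finset.range (r + 1), d ^ q * r.choose q *
            (w ^ (2 * (i + (r - q))) * Real.exp (-(Real.pi * s ^ 2) * w ^ 2)) := by
    ext w
    have e1 : Real.exp (-Real.pi * ((s * w) ^ 2 + 2 * s ^ 2)) =
        Real.exp (-(2 * (Real.pi * s ^ 2))) * Real.exp (-(Real.pi * s ^ 2) * w ^ 2) := by
      rw [← Real.exp_add]
      congr 1
      ring
    have e2 : ∀ r, (Real.pi * ((s * w) ^ 2 + d * s ^ 2)) ^ r = (Real.pi * s ^ 2) ^ r *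
        ∑ q ∈ Finset.range (r + 1), d ^ q * r.choose q * w ^ (2 * (r - q)) := by
      intro r
      rw [show Real.pi * ((s * w) ^ 2 + d * s ^ 2) = Real.pi * s ^ 2 * (d + w ^ 2) by ring, mul_pow,
        add_pow]
      congr 1
      refine Finset.sum_congr rfl fun q _ => ?_
      rw [← pow_mul]
      ring
    have e3 : ∀ A B C D : ℝ, A * (B * (C * D)) = C * (A * (B * D)) := fun _ _ _ _ => by ring
    rw [e1, e3]
    congr 1
    rw [Finset.sum_mul]
    refine Finset.sum_congr rfl fun i _ => ?_
    rw [mul_assoc]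
    congr 1
    rw [Finset.sum_mul, Finset.mul_sum]
    refine Finset.sum_congr rfl fun r _ => ?_
    have e4 : ∀ A B C D E : ℝ, A * (B * (C * D) * E) = B * C * (A * D * E) :=
      fun _ _ _ _ _ => by ring
    rw [e2, e4]
    congr 1
    rw [Finset.mul_sum, Finset.sum_mul]
    refine Finset.sum_congr rfl fun q _ => ?_
    rw [mul_add 2, pow_add]
    ring
  have hi3 : ∀ i r q : ℕ, Integrable fun w : ℝ => d ^ q * r.choose q *
      (w ^ (2 * (i + (r - q))) * Real.exp (-(Real.pi * s ^ 2) * w ^ 2)) := fun i r q =>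
    (integrable_pow_mul_exp _ hv _).const_mul _
  have hi2 : ∀ i r : ℕ, Integrable fun w : ℝ => hermiteCoeff K r * (Real.pi * s ^ 2) ^ r *
      ∑ q ∈ Finset.range (r + 1), d ^ q * r.choose q *
        (w ^ (2 * (i + (r - q))) * Real.exp (-(Real.pi * s ^ 2) * w ^ 2)) := fun i r =>
    (integrable_finsetSum _ fun q _ => hi3 i r q).const_mul _
  have hi1 : ∀ i : ℕ, Integrable fun w : ℝ => ((L + i).choose (2 * i) : ℝ) *
      ∑ r ∈ Finset.range (K + 1), hermiteCoeff K r * (Real.pi * s ^ 2) ^ r *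
        ∑ q ∈ Finset.range (r + 1), d ^ q * r.choose q *
          (w ^ (2 * (i + (r - q))) * Real.exp (-(Real.pi * s ^ 2) * w ^ 2)) := fun i =>
    (integrable_finsetSum _ fun r _ => hi2 i r).const_mul _
  rw [h1]
  refine ⟨(integrable_finsetSum _ fun i _ => hi1 i).const_mul _, ?_⟩
  have hsq : Real.sqrt (Real.pi / (Real.pi * s ^ 2)) = s⁻¹ := by
    rw [show Real.pi / (Real.pi * s ^ 2) = s⁻¹ ^ 2 by field_simp]
    exact Real.sqrt_sq (by positivity)
  rw [integral_const_mul, integral_finsetSum _ fun i _ => hi1 i, mul_left_comm, Finset.mul_sum]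
  congr 1
  refine Finset.sum_congr rfl fun i _ => ?_
  rw [integral_const_mul, integral_finsetSum _ fun r _ => hi2 i r, mul_left_comm, Finset.mul_sum]
  congr 1
  refine Finset.sum_congr rfl fun r _ => ?_
  rw [integral_const_mul, integral_finsetSum _ fun q _ => hi3 i r q, mul_left_comm, Finset.mul_sum]
  congr 1
  refine Finset.sum_congr rfl fun q _ => ?_
  rw [integral_const_mul, integral_pow_mul_exp _ hv, hsq]
  field_simp

theorem zpow_mul_integral_Phi_div (k : ℤ) (L : ℕ) (y d : ℝ) (hy : y ≠ 0)
    (hd : ∀ a : ℝ, a ≠ 0 →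
      (a + Int.sign k * (a⁻¹ * y)) ^ 2 = (a - |y| / a) ^ 2 + d * |y|) :
    (IntegrableOn (fun a : ℝ =>
        ((|a| ^ ((1 : ℤ) - 2 * (L + 1 : ℕ)) : ℝ) : ℂ) *
          (∫ x : ℝ, Phi k (a⁻¹ * y) x * Complex.exp (-(2 * Real.pi) * Complex.I * x * a)) /
          ((|a| : ℝ) : ℂ))
      {(0 : ℝ)}ᶜ) ∧
    ((|y| ^ (L + 1) : ℝ) : ℂ) *
      (∫ a in {(0 : ℝ)}ᶜ,
        ((|a| ^ ((1 : ℤ) - 2 * (L + 1 : ℕ)) : ℝ) : ℂ) *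
          (∫ x : ℝ, Phi k (a⁻¹ * y) x * Complex.exp (-(2 * Real.pi) * Complex.I * x * a)) /
          ((|a| : ℝ) : ℂ)) =
    ((Real.exp (-(2 * (Real.pi * |y|))) * ∑ i ∈ Finset.range (L + 1), ((L + i).choose (2 * i) : ℝ) *
      ∑ r ∈ Finset.range (k.natAbs + 1), hermiteCoeff k.natAbs r * (Real.pi * |y|) ^ r *
        ∑ q ∈ Finset.range (r + 1), d ^ q * r.choose q *
          (halfPoch (i + (r - q)) / (Real.pi * |y|) ^ (i + (r - q))) : ℝ) : ℂ) := by
  have hy' : 0 < |y| := abs_pos.mpr hy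
  obtain ⟨s, hs, hsy⟩ : ∃ s : ℝ, 0 < s ∧ s ^ 2 = |y| :=
    ⟨Real.sqrt |y|, Real.sqrt_pos.mpr hy', Real.sq_sqrt hy'.le⟩
  set G : ℝ → ℝ := fun w =>
    (∑ r ∈ Finset.range (k.natAbs + 1), hermiteCoeff k.natAbs r *
      (Real.pi * (w ^ 2 + d * s ^ 2)) ^ r) * Real.exp (-Real.pi * (w ^ 2 + 2 * s ^ 2)) with hG
  obtain ⟨m1, m2⟩ := integral_sum_mul_hermite k.natAbs L s d hs
  obtain ⟨n1, n2⟩ := integral_zpow_mul_comp_sub_div L s hs G (by fun_prop)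
    (fun w => by simp only [hG, neg_sq]) m1
  have hEq : Set.EqOn (fun a : ℝ =>
      ((|a| ^ ((1 : ℤ) - 2 * (L + 1 : ℕ)) : ℝ) : ℂ) *
        (∫ x : ℝ, Phi k (a⁻¹ * y) x * Complex.exp (-(2 * Real.pi) * Complex.I * x * a)) /
        ((|a| : ℝ) : ℂ))
      (fun a : ℝ => ((|a| ^ ((1 : ℤ) - 2 * (L + 1 : ℕ)) * G (a - s ^ 2 / a) / |a| : ℝ) : ℂ))
      {(0 : ℝ)}ᶜ := by
    intro a ha
    have ha : a ≠ 0 := ha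
    have e : a ^ 2 + (a⁻¹ * y) ^ 2 = (a - s ^ 2 / a) ^ 2 + 2 * s ^ 2 := by
      rw [hsy, mul_pow, ← sq_abs y]
      field_simp
      ring
    simp only [integral_Phi_mul_cexp, hG]
    rw [e, hd a ha, ← hsy]
    push_cast
    rfl
  have hms : MeasurableSet ({(0 : ℝ)}ᶜ : Set ℝ) := (measurableSet_singleton 0).compl
  refine ⟨(integrableOn_congr_fun hEq hms).mpr n1.ofReal, ?_⟩
  rw [setIntegral_congr_fun hms hEq, ← hsy, ← m2, integral_complex_ofReal, ← Complex.ofReal_mul]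
  refine congrArg Complex.ofReal ?_
  rw [← n2]
  ring

/-- (The identity \eqref{eqn:Wphidiagdiscrete}.) For `k ∈ ℤ`, `k ≠ 0`,
`1 ≤ ℓ ≤ |k|`, and `y ≠ 0`, the double integral
`W(y) = |y|^ℓ ∫_{ℝ∖{0}} |a|^{1-2ℓ} (∫_ℝ Φ(a⁻¹y, x) e^{-2πixa} dx) da/|a|`
converges and equals `W_{|k|,ℓ-1/2}(4π|y|)` if `sgn(y) = sgn(k)`, and `0` if
`sgn(y) = -sgn(k)`. -/
theorem stmt8 (k : ℤ) (hk : k ≠ 0) (l : ℕ) (hl : 1 ≤ l) (hlk : (l : ℤ) ≤ |k|)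
    (y : ℝ) (hy : y ≠ 0) :
    (∀ a : ℝ, a ≠ 0 → Integrable (fun x : ℝ =>
        Phi k (a⁻¹ * y) x * Complex.exp (-(2 * Real.pi) * Complex.I * x * a))) ∧
    IntegrableOn (fun a : ℝ =>
        ((|a| ^ ((1 : ℤ) - 2 * l) : ℝ) : ℂ) *
          (∫ x : ℝ, Phi k (a⁻¹ * y) x * Complex.exp (-(2 * Real.pi) * Complex.I * x * a)) /
          ((|a| : ℝ) : ℂ))
      {(0 : ℝ)}ᶜ ∧
    (Real.sign y = (Int.sign k : ℝ) →
      ((|y| ^ l : ℝ) : ℂ) *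
          (∫ a in {(0 : ℝ)}ᶜ,
            ((|a| ^ ((1 : ℤ) - 2 * l) : ℝ) : ℂ) *
              (∫ x : ℝ, Phi k (a⁻¹ * y) x *
                Complex.exp (-(2 * Real.pi) * Complex.I * x * a)) /
              ((|a| : ℝ) : ℂ)) =
        ((Whol k.natAbs l (4 * Real.pi * |y|) : ℝ) : ℂ)) ∧
    (Real.sign y = -(Int.sign k : ℝ) →
      ((|y| ^ l : ℝ) : ℂ) *
          (∫ a in {(0 : ℝ)}ᶜ,
            ((|a| ^ ((1 : ℤ) - 2 * l) : ℝ) : ℂ) *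
              (∫ x : ℝ, Phi k (a⁻¹ * y) x *
                Complex.exp (-(2 * Real.pi) * Complex.I * x * a)) /
              ((|a| : ℝ) : ℂ)) = 0) := by
  obtain ⟨L, rfl⟩ := Nat.exists_eq_add_of_le' hl
  have hL : L < k.natAbs := by
    have : ((L + 1 : ℕ) : ℤ) ≤ k.natAbs := by rwa [Int.natCast_natAbs]
    omega
  have hv : Real.pi * |y| ≠ 0 := mul_ne_zero Real.pi_ne_zero (abs_ne_zero.mpr hy)
  have hsame : Int.sign k * y = |y| → ∀ a : ℝ, a ≠ 0 →
      (a + Int.sign k * (a⁻¹ * y)) ^ 2 = (a - |y| / a) ^ 2 + 4 * |y| := by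
    intro h a ha
    rw [mul_left_comm, h]
    field_simp
    ring
  have hopp : Int.sign k * y = -|y| → ∀ a : ℝ, a ≠ 0 →
      (a + Int.sign k * (a⁻¹ * y)) ^ 2 = (a - |y| / a) ^ 2 + 0 * |y| := by
    intro h a ha
    rw [mul_left_comm, h]
    field_simp
    ring
  have hsign : (Int.sign k : ℝ) * Int.sign k = 1 := by
    rcases hk.lt_or_gt with h | h
    · simp [Int.sign_eq_neg_one_of_neg h]
    · simp [Int.sign_eq_one_of_pos h]
  have hyabs : Real.sign y * y = |y| := by
    rcases hy.lt_or_gt with h | h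
    · rw [Real.sign_of_neg h, abs_of_neg h]; ring
    · rw [Real.sign_of_pos h, abs_of_pos h]; ring
  have hcases : Int.sign k * y = |y| ∨ Int.sign k * y = -|y| := by
    rcases mul_self_eq_one_iff.mp hsign with h | h <;> rw [h] <;>
      rcases abs_choice y with h' | h' <;> rw [h'] <;> simp
  refine ⟨fun a _ => integrable_Phi_mul_cexp k (a⁻¹ * y) a, ?_, fun h => ?_, fun h => ?_⟩
  · rcases hcases with h | h
    · exact (zpow_mul_integral_Phi_div k L y 4 hy (hsame h)).1
    · exact (zpow_mul_integral_Phi_div k L y 0 hy (hopp h)).1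
  · rw [(zpow_mul_integral_Phi_div k L y 4 hy (hsame (by rw [← h, hyabs]))).2,
      sum_choose_moment_four _ _ hL _ hv, mul_assoc]
  · rw [(zpow_mul_integral_Phi_div k L y 0 hy (hopp (by rw [← hyabs, h]; ring))).2,
      sum_choose_moment_zero _ _ hL _ hv]
    simp
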